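/- arXiv:1205.5378 — 3 statements merged into one kernel-verified Lean document; each statement's English description precedes it below -/
import Mathlib

section
/- For ρ > 0, T > 0 and u ∈ ℝ, let M_{ρ,T,u}(v) = ρ (2πT)^{−3/2} exp(−((v_x−u)² + v_y² + v_z²)/(2T)) for v = (v_x, v_y, v_z) ∈ ℝ³, and let M(v) = M_{1,1,0}(v) be the standard Maxwellian. There exists a constant C > 0 such that for all ρ₁, ρ₂ ∈ [1/2, 2], T₁, T₂ ∈ [1/2, 3/2], u₁, u₂ ∈ [−1, 1], one has (∫_{ℝ³} (M_{ρ₁,T₁,u₁}(v) − M_{ρ₂,T₂,u₂}(v))² / M(v) dv)^{1/2} ≤ C (|ρ₁ − ρ₂| + |T₁ − T₂| + |u₁ − u₂|). -/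
open MeasureTheory Real

/-- The Maxwellian on `ℝ³` with density `ρ`, temperature `T` and drift `u` in
the `x`-direction. -/
noncomputable def MaxwellRTu (ρ T u : ℝ) (v : Fin 3 → ℝ) : ℝ :=
  ρ * (2 * π * T) ^ (-(3 : ℝ) / 2) *
    exp (-(((v 0 - u) ^ 2 + (v 1) ^ 2 + (v 2) ^ 2) / (2 * T)))

theorem abs_exp_sub_exp_le (x y : ℝ) :
    |exp x - exp y| ≤ |x - y| * (exp x + exp y) := by
  have key : ∀ a b : ℝ, exp a - exp b ≤ |a - b| * (exp a + exp b) := by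
    intro a b
    have h1 : exp b = exp a * exp (b - a) := by rw [← exp_add]; congr 1; ring
    have h2 := mul_le_mul_of_nonneg_left (add_one_le_exp (b - a)) (exp_pos a).le
    have h3 := mul_le_mul_of_nonneg_right (le_abs_self (a - b)) (exp_pos a).le
    have h4 := mul_nonneg (abs_nonneg (a - b)) (exp_pos b).le
    linarith
  rw [abs_le]
  have h1 := key x y
  have h2 := key y x
  rw [abs_sub_comm y x] at h2
  constructor <;> linarith

theorem abs_log_sub_log_le_two_mul {x y : ℝ} (hx : 1 / 2 ≤ x) (hy : 1 / 2 ≤ y) :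
    |log x - log y| ≤ 2 * |x - y| := by
  have key : ∀ {a b : ℝ}, 1 / 2 ≤ a → 1 / 2 ≤ b → log a - log b ≤ 2 * |a - b| := by
    intro a b ha hb
    have hb0 : 0 < b := by linarith
    rw [← log_div (by linarith) (by linarith)]
    refine (log_le_sub_one_of_pos (by positivity)).trans ?_
    rw [div_sub_one hb0.ne', div_le_iff₀ hb0]
    nlinarith [le_abs_self (a - b), abs_nonneg (a - b)]
  rw [abs_le]
  have h1 := key hx hy
  have h2 := key hy hx
  rw [abs_sub_comm y x] at h2
  constructor <;> linarith

/-- A Maxwellian as a single exponential. -/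
theorem MaxwellRTu_eq_exp {ρ T : ℝ} (hρ : 0 < ρ) (hT : 0 < T) (u : ℝ) (v : Fin 3 → ℝ) :
    MaxwellRTu ρ T u v = exp (log ρ + (log (2 * π) + log T) * (-(3 : ℝ) / 2) +
      -(((v 0 - u) ^ 2 + (v 1) ^ 2 + (v 2) ^ 2) / (2 * T))) := by
  have hpi : (0 : ℝ) < 2 * π := by positivity
  rw [exp_add, exp_add, exp_log hρ, ← log_mul hpi.ne' hT.ne', ← rpow_def_of_pos (by positivity)]
  rfl

theorem MaxwellRTu_le {ρ T u : ℝ} (hρ : ρ ∈ Set.Icc (1 / 2 : ℝ) 2)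
    (hT : T ∈ Set.Icc (1 / 2 : ℝ) (3 / 2)) (hu : u ∈ Set.Icc (-1 : ℝ) 1) (v : Fin 3 → ℝ) :
    MaxwellRTu ρ T u v ≤
      2 * exp 3 * exp (-(7 / 24) * ((v 0) ^ 2 + (v 1) ^ 2 + (v 2) ^ 2)) := by
  obtain ⟨hρ1, hρ2⟩ := hρ
  obtain ⟨hT1, hT2⟩ := hT
  obtain ⟨hu1, hu2⟩ := hu
  have hT0 : 0 < T := by linarith
  have hA : (2 * π * T) ^ (-(3 : ℝ) / 2) ≤ 1 :=
    rpow_le_one_of_one_le_of_nonpos (by nlinarith [pi_gt_three]) (by norm_num)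
  have hA0 : 0 ≤ (2 * π * T) ^ (-(3 : ℝ) / 2) := by positivity
  have hE : exp (-(((v 0 - u) ^ 2 + (v 1) ^ 2 + (v 2) ^ 2) / (2 * T))) ≤
      exp 3 * exp (-(7 / 24) * ((v 0) ^ 2 + (v 1) ^ 2 + (v 2) ^ 2)) := by
    rw [← exp_add]
    apply exp_le_exp.mpr
    have h1 : ((v 0 - u) ^ 2 + (v 1) ^ 2 + (v 2) ^ 2) / 3 ≤
        ((v 0 - u) ^ 2 + (v 1) ^ 2 + (v 2) ^ 2) / (2 * T) :=
      div_le_div_of_nonneg_left (by positivity) (by positivity) (by linarith)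
    nlinarith [sq_nonneg (v 0 - 8 * u), sq_nonneg (v 1), sq_nonneg (v 2)]
  have h := mul_le_mul (mul_le_mul hρ2 hA hA0 (by norm_num)) hE (exp_pos _).le (by norm_num)
  unfold MaxwellRTu
  linarith

theorem abs_div_two_mul_sub_le {T₁ T₂ u₁ u₂ : ℝ} (hT₁ : 1 / 2 ≤ T₁) (hT₂ : 1 / 2 ≤ T₂)
    (hu₁ : u₁ ∈ Set.Icc (-1 : ℝ) 1) (hu₂ : u₂ ∈ Set.Icc (-1 : ℝ) 1) (a b c : ℝ) :
    |((a - u₁) ^ 2 + b ^ 2 + c ^ 2) / (2 * T₁) - ((a - u₂) ^ 2 + b ^ 2 + c ^ 2) / (2 * T₂)| ≤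
      (1 + (a ^ 2 + b ^ 2 + c ^ 2)) * (3 * |u₁ - u₂| + 4 * |T₁ - T₂|) := by
  obtain ⟨h1, h2⟩ := hu₁
  obtain ⟨h3, h4⟩ := hu₂
  have hT₁0 : 0 < T₁ := by linarith
  have hT₂0 : 0 < T₂ := by linarith
  have e : ((a - u₁) ^ 2 + b ^ 2 + c ^ 2) / (2 * T₁) - ((a - u₂) ^ 2 + b ^ 2 + c ^ 2) / (2 * T₂) =
      (u₁ - u₂) * ((u₁ + u₂ - 2 * a) / (2 * T₁)) +
      ((a - u₂) ^ 2 + b ^ 2 + c ^ 2) * ((T₂ - T₁) / (2 * T₁ * T₂)) := by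
    field_simp
    ring
  have hU : |(u₁ + u₂ - 2 * a) / (2 * T₁)| ≤ 3 * (1 + (a ^ 2 + b ^ 2 + c ^ 2)) := by
    rw [abs_div, abs_of_pos (by positivity : 0 < 2 * T₁)]
    refine (div_le_self (abs_nonneg _) (by linarith)).trans ?_
    rw [abs_le]
    constructor <;>
      nlinarith [sq_nonneg (a - 1), sq_nonneg (a + 1), sq_nonneg b, sq_nonneg c]
  have hT : |(T₂ - T₁) / (2 * T₁ * T₂)| ≤ 2 * |T₁ - T₂| := by
    rw [abs_div, abs_sub_comm T₂ T₁, abs_of_pos (by positivity : 0 < 2 * T₁ * T₂),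
      div_le_iff₀ (by positivity)]
    have : 1 / 4 ≤ T₁ * T₂ := by nlinarith
    nlinarith [abs_nonneg (T₁ - T₂)]
  have hq : (a - u₂) ^ 2 + b ^ 2 + c ^ 2 ≤ 2 * (1 + (a ^ 2 + b ^ 2 + c ^ 2)) := by
    nlinarith [sq_nonneg (a + u₂), sq_nonneg b, sq_nonneg c]
  rw [e]
  refine (abs_add_le _ _).trans ?_
  rw [abs_mul, abs_mul, abs_of_nonneg (by positivity : 0 ≤ (a - u₂) ^ 2 + b ^ 2 + c ^ 2)]
  have k1 := mul_le_mul_of_nonneg_left hU (abs_nonneg (u₁ - u₂))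
  have k2 := mul_le_mul hq hT (abs_nonneg _) (by positivity)
  linarith

theorem abs_MaxwellRTu_sub_le {ρ₁ ρ₂ T₁ T₂ u₁ u₂ : ℝ}
    (hρ₁ : ρ₁ ∈ Set.Icc (1 / 2 : ℝ) 2) (hρ₂ : ρ₂ ∈ Set.Icc (1 / 2 : ℝ) 2)
    (hT₁ : T₁ ∈ Set.Icc (1 / 2 : ℝ) (3 / 2)) (hT₂ : T₂ ∈ Set.Icc (1 / 2 : ℝ) (3 / 2))
    (hu₁ : u₁ ∈ Set.Icc (-1 : ℝ) 1) (hu₂ : u₂ ∈ Set.Icc (-1 : ℝ) 1) (v : Fin 3 → ℝ) :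
    |MaxwellRTu ρ₁ T₁ u₁ v - MaxwellRTu ρ₂ T₂ u₂ v| ≤
      28 * exp 3 * (|ρ₁ - ρ₂| + |T₁ - T₂| + |u₁ - u₂|) *
        ((1 + ((v 0) ^ 2 + (v 1) ^ 2 + (v 2) ^ 2)) *
          exp (-(7 / 24) * ((v 0) ^ 2 + (v 1) ^ 2 + (v 2) ^ 2))) := by
  have hM := add_le_add (MaxwellRTu_le hρ₁ hT₁ hu₁ v) (MaxwellRTu_le hρ₂ hT₂ hu₂ v)
  have hq := abs_div_two_mul_sub_le hT₁.1 hT₂.1 hu₁ hu₂ (v 0) (v 1) (v 2)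
  have hlρ := abs_log_sub_log_le_two_mul hρ₁.1 hρ₂.1
  have hlT := abs_log_sub_log_le_two_mul hT₁.1 hT₂.1
  have hρ₁0 : 0 < ρ₁ := by linarith [hρ₁.1]
  have hρ₂0 : 0 < ρ₂ := by linarith [hρ₂.1]
  have hT₁0 : 0 < T₁ := by linarith [hT₁.1]
  have hT₂0 : 0 < T₂ := by linarith [hT₂.1]
  rw [MaxwellRTu_eq_exp hρ₁0 hT₁0, MaxwellRTu_eq_exp hρ₂0 hT₂0] at hM ⊢
  refine (abs_exp_sub_exp_le _ _).trans ?_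
  set s := (v 0) ^ 2 + (v 1) ^ 2 + (v 2) ^ 2
  have hs0 : 0 ≤ s := by positivity
  have hx : ∀ {p t q p' t' q' L : ℝ}, |p - p'| ≤ 2 * |ρ₁ - ρ₂| → |t - t'| ≤ 2 * |T₁ - T₂| →
      |q - q'| ≤ (1 + s) * (3 * |u₁ - u₂| + 4 * |T₁ - T₂|) →
      |(p + (L + t) * (-(3 : ℝ) / 2) + -q) - (p' + (L + t') * (-(3 : ℝ) / 2) + -q')| ≤
        7 * (1 + s) * (|ρ₁ - ρ₂| + |T₁ - T₂| + |u₁ - u₂|) := by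
    intro p t q p' t' q' L h1 h2 h3
    have k1 := mul_nonneg hs0 (abs_nonneg (ρ₁ - ρ₂))
    have k2 := mul_nonneg hs0 (abs_nonneg (T₁ - T₂))
    have k3 := mul_nonneg hs0 (abs_nonneg (u₁ - u₂))
    have k4 := abs_nonneg (ρ₁ - ρ₂)
    have k5 := abs_nonneg (T₁ - T₂)
    have k6 := abs_nonneg (u₁ - u₂)
    rw [abs_le] at h1 h2 h3 ⊢
    constructor <;> linarith [h1.1, h1.2, h2.1, h2.2, h3.1, h3.2]
  have hD := hx (L := log (2 * π)) hlρ hlT hq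
  refine (mul_le_mul hD hM (by positivity) (by positivity)).trans (le_of_eq ?_)
  ring

theorem integrable_exp_neg_mul_sq_add_sq_add_sq {b : ℝ} (hb : 0 < b) :
    Integrable (fun v : Fin 3 → ℝ => exp (-b * ((v 0) ^ 2 + (v 1) ^ 2 + (v 2) ^ 2))) := by
  have h := Integrable.fintype_prod (ι := Fin 3) (μ := fun _ => (volume : Measure ℝ))
    (f := fun _ x => exp (-b * x ^ 2)) (fun _ => integrable_exp_neg_mul_sq hb)
  rw [← volume_pi] at h
  refine h.congr (ae_of_all _ fun v => ?_)
  simp only [Fin.prod_univ_three, ← exp_add]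
  congr 1
  ring

theorem sq_mul_exp_div_exp_le {s : ℝ} (hs : 0 ≤ s) :
    ((1 + s) * exp (-(7 / 24) * s)) ^ 2 / exp (-(s / 2)) ≤ 48 ^ 2 * exp (-(1 / 24) * s) := by
  have h1 : 1 + s ≤ 48 * exp (s / 48) := by linarith [add_one_le_exp (s / 48)]
  rw [div_le_iff₀ (exp_pos _)]
  calc ((1 + s) * exp (-(7 / 24) * s)) ^ 2
      ≤ ((48 * exp (s / 48)) * exp (-(7 / 24) * s)) ^ 2 := by gcongr
    _ = 48 ^ 2 * exp (-(1 / 24) * s) * exp (-(s / 2)) := by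
      rw [mul_assoc, ← exp_add, mul_pow, ← exp_nat_mul, mul_assoc, ← exp_add]
      congr 2
      push_cast
      ring

/-- Lipschitz estimate for Maxwellians with respect to density, temperature and
drift parameters, in the weighted `L²(M⁻¹dv)` norm (Corollary 2.1 of the paper). -/
theorem maxwellian_lipschitz_in_parameters :
    ∃ C > 0, ∀ ρ₁ ρ₂ T₁ T₂ u₁ u₂ : ℝ,
      ρ₁ ∈ Set.Icc (1/2 : ℝ) 2 → ρ₂ ∈ Set.Icc (1/2 : ℝ) 2 →
      T₁ ∈ Set.Icc (1/2 : ℝ) (3/2) → T₂ ∈ Set.Icc (1/2 : ℝ) (3/2) →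
      u₁ ∈ Set.Icc (-1 : ℝ) 1 → u₂ ∈ Set.Icc (-1 : ℝ) 1 →
      Real.sqrt (∫ v : Fin 3 → ℝ,
          (MaxwellRTu ρ₁ T₁ u₁ v - MaxwellRTu ρ₂ T₂ u₂ v) ^ 2 / MaxwellRTu 1 1 0 v) ≤
        C * (|ρ₁ - ρ₂| + |T₁ - T₂| + |u₁ - u₂|) := by
  set A : ℝ := (2 * π) ^ (-(3 : ℝ) / 2) with hA
  have hA0 : 0 < A := by positivity
  set G : (Fin 3 → ℝ) → ℝ :=
    fun v => exp (-(1 / 24) * ((v 0) ^ 2 + (v 1) ^ 2 + (v 2) ^ 2)) with hG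
  have hGi : Integrable G := integrable_exp_neg_mul_sq_add_sq_add_sq (by norm_num)
  set K : ℝ := (28 * exp 3) ^ 2 * 48 ^ 2 / A * ∫ v, G v with hK
  refine ⟨√K + 1, by positivity, ?_⟩
  intro ρ₁ ρ₂ T₁ T₂ u₁ u₂ hρ₁ hρ₂ hT₁ hT₂ hu₁ hu₂
  set D := |ρ₁ - ρ₂| + |T₁ - T₂| + |u₁ - u₂|
  have hD0 : 0 ≤ D := by positivity
  have hM : ∀ v : Fin 3 → ℝ, MaxwellRTu 1 1 0 v =
      A * exp (-(((v 0) ^ 2 + (v 1) ^ 2 + (v 2) ^ 2) / 2)) := by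
    intro v
    simp [MaxwellRTu, hA]
  have hpt : ∀ v : Fin 3 → ℝ,
      (MaxwellRTu ρ₁ T₁ u₁ v - MaxwellRTu ρ₂ T₂ u₂ v) ^ 2 / MaxwellRTu 1 1 0 v ≤
        (28 * exp 3) ^ 2 * 48 ^ 2 / A * D ^ 2 * G v := by
    intro v
    have h := abs_MaxwellRTu_sub_le hρ₁ hρ₂ hT₁ hT₂ hu₁ hu₂ v
    rw [← sq_abs, hM v]
    simp only [hG]
    set s := (v 0) ^ 2 + (v 1) ^ 2 + (v 2) ^ 2
    calc _ ≤ (28 * exp 3 * D * ((1 + s) * exp (-(7 / 24) * s))) ^ 2 / (A * exp (-(s / 2))) := by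
            gcongr
      _ = (28 * exp 3 * D) ^ 2 / A *
            (((1 + s) * exp (-(7 / 24) * s)) ^ 2 / exp (-(s / 2))) := by
            rw [mul_pow _ ((1 + s) * _), mul_div_mul_comm]
      _ ≤ (28 * exp 3 * D) ^ 2 / A * (48 ^ 2 * exp (-(1 / 24) * s)) := by
            gcongr
            exact sq_mul_exp_div_exp_le (by positivity)
      _ = _ := by ring
  have hint : ∫ v : Fin 3 → ℝ,
      (MaxwellRTu ρ₁ T₁ u₁ v - MaxwellRTu ρ₂ T₂ u₂ v) ^ 2 / MaxwellRTu 1 1 0 v ≤ K * D ^ 2 := by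
    refine (integral_mono_of_nonneg (ae_of_all _ fun v => ?_) (hGi.const_mul _)
      (ae_of_all _ hpt)).trans (le_of_eq ?_)
    · simp only [Pi.zero_apply, hM v]
      positivity
    · rw [integral_const_mul, hK]
      ring
  calc _ ≤ √(K * D ^ 2) := sqrt_le_sqrt hint
    _ = √K * D := by rw [sqrt_mul' _ (sq_nonneg D), sqrt_sq hD0]
    _ ≤ (√K + 1) * D := by nlinarith
end

section
/- Fix 𝔘 ∈ ℝ, let M_𝔘(v) = (2π)^{−3/2} exp(−((v_x−𝔘)² + v_y² + v_z²)/2) for v = (v_x, v_y, v_z) ∈ ℝ³, and for differentiable f : ℝ³ → ℝ define (N f)(v) = v_x² ∂f/∂v_y − v_x v_y ∂f/∂v_x − 𝔘 v_x v_y f(v). Then for every Schwartz function f : ℝ³ → ℝ, ∫_{ℝ³} M_𝔘(v) f(v) (N f)(v) dv = (1/2) ∫_{ℝ³} M_𝔘(v) v_y f(v)² dv − (𝔘/2) ∫_{ℝ³} M_𝔘(v) v_x v_y f(v)² dv. -/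
open MeasureTheory Real

/-- The Maxwellian on `ℝ³` drifted by `𝔘` in the `x`-direction. -/
noncomputable def Mdrift (𝔘 : ℝ) (v : Fin 3 → ℝ) : ℝ :=
  (2 * π) ^ (-(3 : ℝ) / 2) * exp (-(((v 0 - 𝔘) ^ 2 + (v 1) ^ 2 + (v 2) ^ 2) / 2))

/-- The (conjugated) force operator from the cylindrical geometry:
`(N f)(v) = vₓ² ∂f/∂v_y − vₓ v_y ∂f/∂vₓ − 𝔘 vₓ v_y f(v)`. -/
noncomputable def Nforce (𝔘 : ℝ) (f : (Fin 3 → ℝ) → ℝ) (v : Fin 3 → ℝ) : ℝ :=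
  (v 0) ^ 2 * fderiv ℝ f v (Pi.single 1 1) - v 0 * v 1 * fderiv ℝ f v (Pi.single 0 1)
    - 𝔘 * v 0 * v 1 * f v

theorem SchwartzMap.integrable_bdd_mul_temperate_mul_mul {M w : (Fin 3 → ℝ) → ℝ} {C : ℝ}
    (hM : Continuous M) (hMC : ∀ v, ‖M v‖ ≤ C) (hw : w.HasTemperateGrowth)
    (f g : SchwartzMap (Fin 3 → ℝ) ℝ) :
    Integrable (fun v ↦ M v * w v * f v * g v) := by
  have h := ((SchwartzMap.smulLeftCLM ℝ w f).integrable (μ := volume)).bdd_mul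
    hM.aestronglyMeasurable (.of_forall hMC)
  refine (h.mul_bdd g.continuous.aestronglyMeasurable
    (.of_forall (SchwartzMap.norm_le_seminorm ℝ g))).congr (.of_forall fun v ↦ ?_)
  simp [SchwartzMap.smulLeftCLM_apply_apply hw, mul_assoc]

theorem continuous_Mdrift (𝔘 : ℝ) : Continuous (Mdrift 𝔘) := by
  unfold Mdrift
  fun_prop

theorem norm_Mdrift_le (𝔘 : ℝ) (v : Fin 3 → ℝ) : ‖Mdrift 𝔘 v‖ ≤ (2 * π) ^ (-(3 : ℝ) / 2) := by
  have hc : (0 : ℝ) ≤ (2 * π) ^ (-(3 : ℝ) / 2) := by positivity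
  rw [Mdrift, norm_mul, norm_of_nonneg hc, norm_of_nonneg (exp_pos _).le]
  refine mul_le_of_le_one_right hc (exp_le_one_iff.2 ?_)
  have : 0 ≤ ((v 0 - 𝔘) ^ 2 + (v 1) ^ 2 + (v 2) ^ 2) / 2 := by positivity
  linarith

theorem integrable_Mdrift_mul (𝔘 : ℝ) {w : (Fin 3 → ℝ) → ℝ} (hw : w.HasTemperateGrowth)
    (f g : SchwartzMap (Fin 3 → ℝ) ℝ) :
    Integrable (fun v ↦ Mdrift 𝔘 v * w v * f v * g v) :=
  SchwartzMap.integrable_bdd_mul_temperate_mul_mul (continuous_Mdrift 𝔘) (norm_Mdrift_le 𝔘) hw f g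

theorem hasTemperateGrowth_coord (i : Fin 3) :
    (fun v : Fin 3 → ℝ ↦ v i).HasTemperateGrowth :=
  (ContinuousLinearMap.proj (R := ℝ) (φ := fun _ : Fin 3 ↦ ℝ) i).hasTemperateGrowth

theorem integrable_Mdrift_mul_fderiv (𝔘 : ℝ) {w : (Fin 3 → ℝ) → ℝ} (hw : w.HasTemperateGrowth)
    (f : SchwartzMap (Fin 3 → ℝ) ℝ) (e : Fin 3 → ℝ) :
    Integrable (fun v ↦ Mdrift 𝔘 v * w v * f v * fderiv ℝ f v e) := by
  simpa only [SchwartzMap.lineDerivOp_apply_eq_fderiv] using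
    integrable_Mdrift_mul 𝔘 hw f (LineDeriv.lineDerivOp e f)

/-- Integration by parts in `L²(M_𝔘 dv)` against a weight `w`, where `M_𝔘 w'` is the derivative of
`M_𝔘 w` in the direction `e`. -/
theorem integral_Mdrift_mul_fderiv (𝔘 : ℝ) {w w' : (Fin 3 → ℝ) → ℝ} {e : Fin 3 → ℝ}
    (hw : w.HasTemperateGrowth) (hw' : w'.HasTemperateGrowth)
    (h : ∀ v, HasLineDerivAt ℝ (fun v ↦ Mdrift 𝔘 v * w v) (Mdrift 𝔘 v * w' v) v e)
    (f : SchwartzMap (Fin 3 → ℝ) ℝ) :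
    ∫ v, Mdrift 𝔘 v * w v * f v * fderiv ℝ f v e =
      -(1 / 2) * ∫ v, Mdrift 𝔘 v * w' v * f v * f v := by
  have key := integral_bilinear_hasLineDerivAt_right_eq_neg_left_of_integrable
    (μ := (volume : Measure (Fin 3 → ℝ))) (B := ContinuousLinearMap.mul ℝ ℝ)
    (f := fun v ↦ Mdrift 𝔘 v * w v) (f' := fun v ↦ Mdrift 𝔘 v * w' v)
    (g := fun v ↦ f v * f v) (g' := fun v ↦ 2 * (f v * fderiv ℝ f v e)) (v := e)
    ((integrable_Mdrift_mul 𝔘 hw' f f).congr (.of_forall fun v ↦ by simp [mul_assoc]))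
    (((integrable_Mdrift_mul_fderiv 𝔘 hw f e).const_mul 2).congr
      (.of_forall fun v ↦ by simp only [ContinuousLinearMap.mul_apply']; ring))
    ((integrable_Mdrift_mul 𝔘 hw f f).congr (.of_forall fun v ↦ by simp [mul_assoc]))
    (fun v _ ↦ h v)
    (fun v _ ↦ by
      have hf := ((f.hasFDerivAt v).mul (f.hasFDerivAt v)).hasLineDerivAt e
      convert! hf using 1
      simp only [add_apply, smul_apply, smul_eq_mul]
      ring)
  simp only [ContinuousLinearMap.mul_apply', ← mul_assoc] at key
  have h2 : ∫ v, Mdrift 𝔘 v * w v * 2 * f v * fderiv ℝ f v e =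
      2 * ∫ v, Mdrift 𝔘 v * w v * f v * fderiv ℝ f v e := by
    rw [← integral_const_mul]
    congr 1 with v
    ring
  linarith

theorem hasLineDerivAt_Mdrift_zero (𝔘 : ℝ) (v : Fin 3 → ℝ) :
    HasLineDerivAt ℝ (Mdrift 𝔘) (-(v 0 - 𝔘) * Mdrift 𝔘 v) v (Pi.single 0 1) := by
  unfold HasLineDerivAt Mdrift
  have h : HasDerivAt (fun t : ℝ ↦ -(((v 0 + t - 𝔘) ^ 2 + (v 1) ^ 2 + (v 2) ^ 2) / 2))
      (-(v 0 - 𝔘)) 0 := by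
    have := ((((((hasDerivAt_id (0 : ℝ)).const_add (v 0)).sub_const 𝔘).pow 2).add_const
      ((v 1) ^ 2)).add_const ((v 2) ^ 2)).div_const 2 |>.neg
    convert! this using 1
    simp
  convert! h.exp.const_mul ((2 * π) ^ (-(3 : ℝ) / 2)) using 1
  · simp
  · simp; ring

theorem hasLineDerivAt_Mdrift_one (𝔘 : ℝ) (v : Fin 3 → ℝ) :
    HasLineDerivAt ℝ (Mdrift 𝔘) (-v 1 * Mdrift 𝔘 v) v (Pi.single 1 1) := by
  unfold HasLineDerivAt Mdrift
  have h : HasDerivAt (fun t : ℝ ↦ -(((v 0 - 𝔘) ^ 2 + (v 1 + t) ^ 2 + (v 2) ^ 2) / 2))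
      (-v 1) 0 := by
    have := (((((hasDerivAt_id (0 : ℝ)).const_add (v 1)).pow 2).const_add
      ((v 0 - 𝔘) ^ 2)).add_const ((v 2) ^ 2)).div_const 2 |>.neg
    convert! this using 1
    simp
  convert! h.exp.const_mul ((2 * π) ^ (-(3 : ℝ) / 2)) using 1
  · simp
  · simp; ring

theorem hasLineDerivAt_Mdrift_mul_sq (𝔘 : ℝ) (v : Fin 3 → ℝ) :
    HasLineDerivAt ℝ (fun v ↦ Mdrift 𝔘 v * v 0 ^ 2) (Mdrift 𝔘 v * -(v 0 ^ 2 * v 1)) v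
      (Pi.single 1 1) := by
  have h := HasDerivAt.mul_const (hasLineDerivAt_Mdrift_one 𝔘 v) (v 0 ^ 2)
  unfold HasLineDerivAt
  convert! h using 1
  · simp
  · ring

theorem hasLineDerivAt_Mdrift_mul_mul (𝔘 : ℝ) (v : Fin 3 → ℝ) :
    HasLineDerivAt ℝ (fun v ↦ Mdrift 𝔘 v * (v 0 * v 1))
      (Mdrift 𝔘 v * (v 1 - (v 0 - 𝔘) * (v 0 * v 1))) v (Pi.single 0 1) := by
  have h := HasDerivAt.mul (hasLineDerivAt_Mdrift_zero 𝔘 v)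
    (((hasDerivAt_id (0 : ℝ)).const_add (v 0)).mul_const (v 1))
  unfold HasLineDerivAt
  convert! h using 1
  · ext t; simp
  · simp; ring

/-- Identity (3.4) of the paper:
`(g, N g) = ½ (v_y g, g) − ½ 𝔘 (vₓ v_y g, g)` in `L²(ℝ³, M_𝔘 dv)`. -/
theorem force_quadratic_identity (𝔘 : ℝ) (f : SchwartzMap (Fin 3 → ℝ) ℝ) :
    ∫ v : Fin 3 → ℝ, Mdrift 𝔘 v * f v * Nforce 𝔘 (⇑f) v =
      (1 / 2) * (∫ v : Fin 3 → ℝ, Mdrift 𝔘 v * v 1 * (f v) ^ 2)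
        - (𝔘 / 2) * (∫ v : Fin 3 → ℝ, Mdrift 𝔘 v * v 0 * v 1 * (f v) ^ 2) := by
  have t0 := hasTemperateGrowth_coord 0
  have t1 := hasTemperateGrowth_coord 1
  have txx : (fun v : Fin 3 → ℝ ↦ v 0 ^ 2).HasTemperateGrowth := t0.pow 2
  have txy : (fun v : Fin 3 → ℝ ↦ v 0 * v 1).HasTemperateGrowth := t0.mul t1
  have txxy : (fun v : Fin 3 → ℝ ↦ v 0 ^ 2 * v 1).HasTemperateGrowth := txx.mul t1
  have t' : (fun v : Fin 3 → ℝ ↦ v 1 - (v 0 - 𝔘) * (v 0 * v 1)).HasTemperateGrowth :=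
    t1.sub ((t0.sub (.const 𝔘)).mul txy)
  have e1 := integral_Mdrift_mul_fderiv 𝔘 txx txxy.neg (hasLineDerivAt_Mdrift_mul_sq 𝔘) f
  have e0 := integral_Mdrift_mul_fderiv 𝔘 txy t' (hasLineDerivAt_Mdrift_mul_mul 𝔘) f
  have i1 := integrable_Mdrift_mul_fderiv 𝔘 txx f (Pi.single 1 1)
  have i0 := integrable_Mdrift_mul_fderiv 𝔘 txy f (Pi.single 0 1)
  have jxy := integrable_Mdrift_mul 𝔘 txy f f
  have jy := integrable_Mdrift_mul 𝔘 t1 f f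
  have jxxy := integrable_Mdrift_mul 𝔘 txxy f f
  have hL : ∫ v : Fin 3 → ℝ, Mdrift 𝔘 v * f v * Nforce 𝔘 (⇑f) v =
      (∫ v, Mdrift 𝔘 v * v 0 ^ 2 * f v * fderiv ℝ f v (Pi.single 1 1))
        - (∫ v, Mdrift 𝔘 v * (v 0 * v 1) * f v * fderiv ℝ f v (Pi.single 0 1))
        - 𝔘 * ∫ v, Mdrift 𝔘 v * (v 0 * v 1) * f v * f v := by
    rw [← integral_const_mul, ← integral_sub' i1 i0,
      ← integral_sub (i1.sub i0) (jxy.const_mul 𝔘)]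
    congr 1 with v
    simp only [Nforce, Pi.sub_apply]
    ring
  have h1 : ∫ v, Mdrift 𝔘 v * -(v 0 ^ 2 * v 1) * f v * f v =
      -∫ v, Mdrift 𝔘 v * (v 0 ^ 2 * v 1) * f v * f v := by
    rw [← integral_neg]
    congr 1 with v
    ring
  have h0 : ∫ v, Mdrift 𝔘 v * (v 1 - (v 0 - 𝔘) * (v 0 * v 1)) * f v * f v =
      (∫ v, Mdrift 𝔘 v * v 1 * f v * f v)
        - (∫ v, Mdrift 𝔘 v * (v 0 ^ 2 * v 1) * f v * f v)
        + 𝔘 * ∫ v, Mdrift 𝔘 v * (v 0 * v 1) * f v * f v := by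
    rw [← integral_const_mul, ← integral_sub' jy jxxy,
      ← integral_add (jy.sub jxxy) (jxy.const_mul 𝔘)]
    congr 1 with v
    simp only [Pi.sub_apply]
    ring
  simp only [Pi.neg_apply] at e1
  rw [hL, e1, e0, h1, h0]
  simp only [pow_two (f _), ← mul_assoc]
  ring
end

section
/- Fix 𝔘 ∈ ℝ, let M_𝔘(v) = (2π)^{−3/2} exp(−((v_x−𝔘)² + v_y² + v_z²)/2), and for differentiable f : ℝ³ → ℝ define (N f)(v) = v_x² ∂f/∂v_y − v_x v_y ∂f/∂v_x − 𝔘 v_x v_y f(v). Set χ̄₀(v) = 1, χ̄₁(v) = v_x − 𝔘, χ̄₃(v) = v_z, χ̄₄(v) = ((v_x−𝔘)² + v_y² + v_z²)/2. Then for all α, β ∈ {0, 1, 3, 4}, ∫_{ℝ³} M_𝔘(v) χ̄_α(v) (N χ̄_β)(v) dv = 0. -/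
open MeasureTheory Real

/-- The drifted collision invariants `χ̄₀ = 1`, `χ̄₁ = vₓ − 𝔘`, `χ̄₂ = v_y`,
`χ̄₃ = v_z`, `χ̄₄ = |v − (𝔘,0,0)|²/2`. -/
noncomputable def chiBar (𝔘 : ℝ) (j : Fin 5) (v : Fin 3 → ℝ) : ℝ :=
  if j = 0 then 1
  else if j = 1 then v 0 - 𝔘
  else if j = 2 then v 1
  else if j = 3 then v 2
  else ((v 0 - 𝔘) ^ 2 + (v 1) ^ 2 + (v 2) ^ 2) / 2

/-- The reflection `v_y ↦ -v_y` of `ℝ³`. -/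
noncomputable def reflectY : (Fin 3 → ℝ) ≃L[ℝ] (Fin 3 → ℝ) :=
  ContinuousLinearEquiv.piCongrRight fun i =>
    if i = 1 then ContinuousLinearEquiv.neg ℝ else ContinuousLinearEquiv.refl ℝ ℝ

@[simp]
lemma reflectY_apply_zero (v : Fin 3 → ℝ) : reflectY v 0 = v 0 := by
  simp [reflectY]

@[simp]
lemma reflectY_apply_one (v : Fin 3 → ℝ) : reflectY v 1 = -v 1 := by
  simp [reflectY]

@[simp]
lemma reflectY_apply_two (v : Fin 3 → ℝ) : reflectY v 2 = v 2 := by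
  simp [reflectY]

lemma measurePreserving_reflectY : MeasurePreserving reflectY volume volume := by
  refine volume_preserving_pi
    (f := fun i : Fin 3 => ((if i = 1 then ContinuousLinearEquiv.neg ℝ
      else ContinuousLinearEquiv.refl ℝ ℝ : ℝ ≃L[ℝ] ℝ) : ℝ → ℝ)) fun i => ?_
  by_cases hi : i = 1
  · subst hi
    exact Measure.measurePreserving_neg (volume : Measure ℝ)
  · simpa [hi] using MeasurePreserving.id (volume : Measure ℝ)

/-- A function that is odd under `v_y ↦ -v_y` has vanishing integral. -/
lemma integral_eq_zero_of_odd_reflectY {g : (Fin 3 → ℝ) → ℝ}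
    (hg : ∀ v, g (reflectY v) = -g v) : ∫ v, g v = 0 := by
  have h := measurePreserving_reflectY.integral_comp
    reflectY.toHomeomorph.measurableEmbedding g
  simp only [hg, integral_neg] at h
  linarith

lemma fderiv_reflectY {f : (Fin 3 → ℝ) → ℝ} (hf : ∀ v, f (reflectY v) = f v)
    (v w : Fin 3 → ℝ) : fderiv ℝ f (reflectY v) (reflectY w) = fderiv ℝ f v w := by
  have hcomp : f ∘ reflectY = f := funext hf
  have h := reflectY.comp_right_fderiv (f := f) (x := v)
  rw [hcomp] at h
  simp [h]

/-- The force operator maps functions even in `v_y` to functions odd in `v_y`. -/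
lemma Nforce_reflectY (𝔘 : ℝ) {f : (Fin 3 → ℝ) → ℝ} (hf : ∀ v, f (reflectY v) = f v)
    (v : Fin 3 → ℝ) : Nforce 𝔘 f (reflectY v) = -Nforce 𝔘 f v := by
  have hx : reflectY (Pi.single 0 1) = Pi.single 0 1 := by
    ext i; fin_cases i <;> simp
  have hy : reflectY (Pi.single 1 1) = -Pi.single 1 1 := by
    ext i; fin_cases i <;> simp
  have h0 := fderiv_reflectY hf v (Pi.single 0 1)
  have h1 := fderiv_reflectY hf v (Pi.single 1 1)
  rw [hx] at h0
  rw [hy, map_neg] at h1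
  simp only [Nforce, reflectY_apply_zero, reflectY_apply_one, hf, h0, ← h1]
  ring

lemma Mdrift_reflectY (𝔘 : ℝ) (v : Fin 3 → ℝ) : Mdrift 𝔘 (reflectY v) = Mdrift 𝔘 v := by
  simp [Mdrift]

lemma chiBar_reflectY (𝔘 : ℝ) {j : Fin 5} (hj : j ≠ 2) (v : Fin 3 → ℝ) :
    chiBar 𝔘 j (reflectY v) = chiBar 𝔘 j v := by
  simp [chiBar, hj]

/-- The parity computation of Section 3 of the paper: `(χ̄_α, N χ̄_β) = 0`
for `α, β ∈ {0, 1, 3, 4}`. -/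
theorem force_invariant_moments_vanish (𝔘 : ℝ) :
    ∀ α ∈ ({0, 1, 3, 4} : Set (Fin 5)), ∀ β ∈ ({0, 1, 3, 4} : Set (Fin 5)),
      ∫ v : Fin 3 → ℝ, Mdrift 𝔘 v * chiBar 𝔘 α v * Nforce 𝔘 (chiBar 𝔘 β) v = 0 := by
  intro α hα β hβ
  have ne_two : ∀ j ∈ ({0, 1, 3, 4} : Set (Fin 5)), j ≠ 2 := by
    rintro j (rfl | rfl | rfl | rfl) <;> decide
  refine integral_eq_zero_of_odd_reflectY fun v => ?_
  rw [Mdrift_reflectY, chiBar_reflectY 𝔘 (ne_two α hα),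
    Nforce_reflectY 𝔘 (chiBar_reflectY 𝔘 (ne_two β hβ)), mul_neg]
end
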